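/- For every R₀ > 1, there exists a unique b* ∈ (1/R₀, 1] such that 2·I_max(b*) = 1 - b*, where I_max(b) = 1 - 1/(b·R₀) + (1/(b·R₀))·ln(1/(b·R₀)); moreover, for every b ∈ (1/R₀, b*], it holds that 2·I_max(b) ≤ 1 - b. -/

import Mathlib

theorem g_anti_aux (x y : ℝ) (hx : 0 < x) (hxy : x < y) (hy : y ≤ 1) :
    1 - y + y * Real.log y < 1 - x + x * Real.log x := by
  have hy0 : 0 < y := hx.trans hxy
  have h1 : Real.log (y / x) < y / x - 1 := by
    apply Real.log_lt_sub_one_of_pos (by positivity)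
    intro h
    rw [div_eq_one_iff_eq hx.ne'] at h
    linarith
  rw [Real.log_div hy0.ne' hx.ne'] at h1
  have h2 : Real.log y ≤ 0 := Real.log_nonpos hy0.le hy
  have h3 := mul_lt_mul_of_pos_left h1 hx
  have h4 : x * (y / x - 1) = y - x := by field_simp
  rw [h4] at h3
  nlinarith [mul_nonneg (sub_nonneg.2 hxy.le) (neg_nonneg.2 h2)]

theorem exists_unique_bstar (R₀ : ℝ) (hR₀ : 1 < R₀)
    (Imax : ℝ → ℝ)
    (hImax : ∀ b, Imax b = 1 - 1 / (b * R₀) + 1 / (b * R₀) * Real.log (1 / (b * R₀))) :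
    ∃ bstar ∈ Set.Ioc (1 / R₀) (1 : ℝ),
      2 * Imax bstar = 1 - bstar ∧
      (∀ b ∈ Set.Ioc (1 / R₀) (1 : ℝ), 2 * Imax b = 1 - b → b = bstar) ∧
      (∀ b ∈ Set.Ioc (1 / R₀) bstar, 2 * Imax b ≤ 1 - b) := by
  have hR : 0 < R₀ := by linarith
  have hi : 0 < 1 / R₀ := by positivity
  have hi1 : 1 / R₀ < 1 := by rw [div_lt_one hR]; exact hR₀
  have mono : ∀ a b, 1 / R₀ ≤ a → a < b → Imax a < Imax b := by
    intro a b ha hab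
    have ha0 : 0 < a := hi.trans_le ha
    rw [hImax, hImax]
    have hb0 : 0 < b := ha0.trans hab
    have haR : 1 ≤ a * R₀ := by rwa [div_le_iff₀ hR] at ha
    apply g_anti_aux
    · positivity
    · exact one_div_lt_one_div_of_lt (by positivity) (by nlinarith)
    · rw [div_le_one (by positivity)]; exact haR
  have h0 : Imax (1 / R₀) = 0 := by
    rw [hImax, one_div_mul_cancel hR.ne']; simp
  have hcont : ContinuousOn (fun b => 2 * Imax b - (1 - b)) (Set.Icc (1 / R₀) 1) := by
    have e : Imax = fun b => 1 - 1 / (b * R₀) + 1 / (b * R₀) * Real.log (1 / (b * R₀)) :=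
      funext hImax
    rw [e]
    intro b hb
    have hb0 : 0 < b := hi.trans_le hb.1
    have h1 : b * R₀ ≠ 0 := by positivity
    have h2 : 1 / (b * R₀) ≠ 0 := by positivity
    apply ContinuousAt.continuousWithinAt
    have c : ContinuousAt (fun b : ℝ => 1 / (b * R₀)) b :=
      ContinuousAt.div continuousAt_const (by fun_prop) h1
    have l := c.log h2
    exact (continuousAt_const.mul ((continuousAt_const.sub c).add (c.mul l))).sub (by fun_prop)
  have hm1 := mono (1 / R₀) 1 le_rfl hi1
  obtain ⟨s, hs, hfs⟩ := intermediate_value_Icc hi1.le hcont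
    (show (0 : ℝ) ∈ Set.Icc _ _ from ⟨by simp only [h0]; linarith, by linarith⟩)
  simp only at hfs
  have hs1 : 1 / R₀ < s := by
    rcases hs.1.lt_or_eq with h | h
    · exact h
    · rw [← h, h0] at hfs; linarith
  refine ⟨s, ⟨hs1, hs.2⟩, by linarith, ?_, ?_⟩
  · intro b hb hfb
    rcases lt_trichotomy b s with h | h | h
    · have := mono b s hb.1.le h
      linarith
    · exact h
    · have := mono s b hs1.le h
      linarith
  · intro b hb
    rcases hb.2.lt_or_eq with h | h
    · have := mono b s hb.1.le h
      linarith
    · rw [h]; linarith
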